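/- Tight bound for self-adjusting RLS: For every a ∈ ℤⁿ \ {0ⁿ} and constants α, β satisfying 1 < α ≤ 2, 1/2 < β ≤ 0.9, 2αβ − β − α > 0, α + β > 2 and α²β > 1, the expected optimization time of RLS_{α,β}, started with the all-0 integer string and all-1 velocity vector, on the fitness function f_a is Θ(n · log |a|₁). -/

import Mathlib

open scoped ENNReal BigOperators

/-- The fitness `f_a(x) = ∑ i, |x i − a i|` (to be minimized). -/
def fitness {n : ℕ} (a x : Fin n → ℤ) : ℕ := ∑ i, (x i - a i).natAbs

/-- `|a|₁ = ∑ i, |a i|`. -/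
def normOne {n : ℕ} (a : Fin n → ℤ) : ℕ := ∑ i, (a i).natAbs

/-- `|a|_∞ = max_i |a i|`. -/
def normInf {n : ℕ} (a : Fin n → ℤ) : ℕ := Finset.univ.sup fun i => (a i).natAbs

/-- A state of `RLS_{α,β}`: a search point `x ∈ ℤⁿ` together with a velocity vector
`v ∈ ℝⁿ`. -/
abbrev RlsState (n : ℕ) := (Fin n → ℤ) × (Fin n → ℝ)

/-- The deterministic outcome of one iteration of `RLS_{α,β}` on `f_a` from state `s`,
given that position `i` was chosen and the direction is `+⌊v i⌋` if `b` and `−⌊v i⌋`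
otherwise: the offspring `y` agrees with `x = s.1` except at position `i`; if
`f_a(y) < f_a(x)` the velocity at `i` is multiplied by `α`, otherwise it is replaced by
`max 1 (β·v i)`; if `f_a(y) ≤ f_a(x)` the search point is replaced by `y`. -/
noncomputable def rlsUpdate {n : ℕ} (a : Fin n → ℤ) (α β : ℝ) (s : RlsState n)
    (i : Fin n) (b : Bool) : RlsState n :=
  let y : Fin n → ℤ := Function.update s.1 i (s.1 i + (if b then ⌊s.2 i⌋ else -⌊s.2 i⌋))
  ((if fitness a y ≤ fitness a s.1 then y else s.1),
    Function.update s.2 i (if fitness a y < fitness a s.1 then α * s.2 i else max 1 (β * s.2 i)))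

/-- One-step transition probability of `RLS_{α,β}` on `f_a`: a position `i` is chosen
uniformly at random and the direction is `±⌊v i⌋` with probability `1/2` each. -/
noncomputable def rlsTransP {n : ℕ} (a : Fin n → ℤ) (α β : ℝ) (s s' : RlsState n) : ℝ≥0∞ :=
  ∑ i : Fin n, ∑ b : Bool,
    (1 / (2 * (n : ℝ≥0∞))) * (if s' = rlsUpdate a α β s i b then 1 else 0)

/-- Distribution of the state of `RLS_{α,β}` after `t` iterations, started at the all-`0`
search point with all-`1` velocity vector. -/
noncomputable def rlsDist (n : ℕ) (a : Fin n → ℤ) (α β : ℝ) : ℕ → RlsState n → ℝ≥0∞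
  | 0 => fun s => if s = ((fun _ => 0), fun _ => 1) then 1 else 0
  | t + 1 => fun s' => ∑' s : RlsState n, rlsDist n a α β t s * rlsTransP a α β s s'

/-- Expected optimization time of `RLS_{α,β}` on `f_a` (started at the all-`0` string with
all-`1` velocities): since the optimum is absorbing,
`E[T] = ∑_{t ≥ 0} P(T > t) = ∑_{t ≥ 0} P(f_a(X_t) ≠ 0)`. -/
noncomputable def rlsExpTime (n : ℕ) (a : Fin n → ℤ) (α β : ℝ) : ℝ≥0∞ :=
  ∑' t : ℕ, ∑' s : RlsState n, if fitness a s.1 = 0 then 0 else rlsDist n a α β t s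

/-- Real-valued one-step expectation operator. -/
noncomputable def stepOp {n : ℕ} (a : Fin n → ℤ) (α β : ℝ) (F : RlsState n → ℝ) :
    RlsState n → ℝ :=
  fun s => ∑ i : Fin n, ∑ b : Bool, (1 / (2 * (n : ℝ))) * F (rlsUpdate a α β s i b)

/-- Indicator of non-optimality. -/
noncomputable def nonOpt {n : ℕ} (a : Fin n → ℤ) (s : RlsState n) : ℝ :=
  if fitness a s.1 = 0 then 0 else 1

lemma stepOp_nonneg {n : ℕ} (a : Fin n → ℤ) (α β : ℝ) {F : RlsState n → ℝ}
    (hF : ∀ s, 0 ≤ F s) (s : RlsState n) : 0 ≤ stepOp a α β F s := by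
  unfold stepOp
  exact Finset.sum_nonneg fun i _ => Finset.sum_nonneg fun b _ =>
    mul_nonneg (by positivity) (hF _)

lemma stepOp_iter_nonneg {n : ℕ} (a : Fin n → ℤ) (α β : ℝ) (t : ℕ) :
    ∀ {F : RlsState n → ℝ}, (∀ s, 0 ≤ F s) → ∀ s, 0 ≤ (stepOp a α β)^[t] F s := by
  induction t with
  | zero => intro F hF s; simpa using hF s
  | succ t ih =>
    intro F hF s
    rw [Function.iterate_succ_apply]
    exact ih (stepOp_nonneg a α β hF) s

lemma tsum_trans {n : ℕ} (hn : 0 < n) (a : Fin n → ℤ) (α β : ℝ) {F : RlsState n → ℝ}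
    (hF : ∀ s, 0 ≤ F s) (s : RlsState n) :
    ∑' s', rlsTransP a α β s s' * ENNReal.ofReal (F s') =
      ENNReal.ofReal (stepOp a α β F s) := by
  unfold rlsTransP stepOp
  have hn' : (0 : ℝ) < 2 * n := by positivity
  have hc : (1 / (2 * (n : ℝ≥0∞))) = ENNReal.ofReal (1 / (2 * (n : ℝ))) := by
    rw [ENNReal.ofReal_div_of_pos hn', ENNReal.ofReal_mul (by norm_num)]
    simp
  simp_rw [Finset.sum_mul]
  rw [Summable.tsum_finsetSum (fun _ _ => ENNReal.summable),
    ENNReal.ofReal_sum_of_nonneg (fun i _ => Finset.sum_nonneg fun b _ =>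
      mul_nonneg (by positivity) (hF _))]
  refine Finset.sum_congr rfl fun i _ => ?_
  rw [Summable.tsum_finsetSum (fun _ _ => ENNReal.summable),
    ENNReal.ofReal_sum_of_nonneg (fun b _ => mul_nonneg (by positivity) (hF _))]
  refine Finset.sum_congr rfl fun b _ => ?_
  rw [tsum_eq_single (rlsUpdate a α β s i b)]
  · rw [ENNReal.ofReal_mul (by positivity), hc]; simp
  · intro s' hs'; simp [hs']

lemma dist_expect {n : ℕ} (hn : 0 < n) (a : Fin n → ℤ) (α β : ℝ) (t : ℕ) :
    ∀ {F : RlsState n → ℝ}, (∀ s, 0 ≤ F s) →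
    ∑' s, rlsDist n a α β t s * ENNReal.ofReal (F s) =
      ENNReal.ofReal ((stepOp a α β)^[t] F ((fun _ => 0), fun _ => 1)) := by
  induction t with
  | zero =>
    intro F hF
    simp only [rlsDist, Function.iterate_zero, id]
    rw [tsum_eq_single ((fun _ => 0), fun _ => 1)]
    · simp
    · intro s' hs'; simp [hs']
  | succ t ih =>
    intro F hF
    rw [Function.iterate_succ_apply, ← ih (stepOp_nonneg a α β hF)]
    simp only [rlsDist]
    simp_rw [← tsum_trans hn a α β hF, ← ENNReal.tsum_mul_right, ← ENNReal.tsum_mul_left]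
    rw [ENNReal.tsum_comm]
    simp_rw [mul_assoc]

lemma nonOpt_nonneg {n : ℕ} (a : Fin n → ℤ) (s : RlsState n) : 0 ≤ nonOpt a s := by
  unfold nonOpt; split_ifs <;> norm_num

lemma expTime_eq {n : ℕ} (hn : 0 < n) (a : Fin n → ℤ) (α β : ℝ) :
    rlsExpTime n a α β = ∑' t : ℕ,
      ENNReal.ofReal ((stepOp a α β)^[t] (nonOpt a) ((fun _ => 0), fun _ => 1)) := by
  unfold rlsExpTime
  refine tsum_congr fun t => ?_
  rw [← dist_expect hn a α β t (nonOpt_nonneg a)]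
  refine tsum_congr fun s => ?_
  unfold nonOpt
  split_ifs <;> simp

lemma stepOp_iter_mono {n : ℕ} (a : Fin n → ℤ) (α β : ℝ) (Inv : RlsState n → Prop)
    (hInv : ∀ s i b, Inv s → Inv (rlsUpdate a α β s i b)) (t : ℕ) :
    ∀ {F G : RlsState n → ℝ}, (∀ s, Inv s → F s ≤ G s) →
    ∀ s, Inv s → (stepOp a α β)^[t] F s ≤ (stepOp a α β)^[t] G s := by
  induction t with
  | zero => intro F G h s hs; simpa using h s hs
  | succ t ih =>
    intro F G h s hs
    rw [Function.iterate_succ_apply, Function.iterate_succ_apply]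
    refine ih (fun s hs => ?_) s hs
    unfold stepOp
    exact Finset.sum_le_sum fun i _ => Finset.sum_le_sum fun b _ =>
      mul_le_mul_of_nonneg_left (h _ (hInv _ _ _ hs)) (by positivity)

lemma stepOp_smul {n : ℕ} (a : Fin n → ℤ) (α β c : ℝ) (F : RlsState n → ℝ) :
    stepOp a α β (fun s => c * F s) = fun s => c * stepOp a α β F s := by
  funext s
  unfold stepOp
  simp_rw [Finset.mul_sum]
  refine Finset.sum_congr rfl fun i _ => Finset.sum_congr rfl fun b _ => by ring

lemma stepOp_add {n : ℕ} (a : Fin n → ℤ) (α β : ℝ) (F G : RlsState n → ℝ) :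
    stepOp a α β (fun s => F s + G s) = fun s => stepOp a α β F s + stepOp a α β G s := by
  funext s
  unfold stepOp
  simp_rw [← Finset.sum_add_distrib]
  refine Finset.sum_congr rfl fun i _ => Finset.sum_congr rfl fun b _ => by ring

lemma stepOp_iter_smul {n : ℕ} (a : Fin n → ℤ) (α β c : ℝ) (t : ℕ) :
    ∀ (F : RlsState n → ℝ),
    (stepOp a α β)^[t] (fun s => c * F s) = fun s => c * (stepOp a α β)^[t] F s := by
  induction t with
  | zero => intro F; rfl
  | succ t ih => intro F; rw [Function.iterate_succ_apply, stepOp_smul, ih]; rfl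

lemma stepOp_iter_add {n : ℕ} (a : Fin n → ℤ) (α β : ℝ) (t : ℕ) :
    ∀ (F G : RlsState n → ℝ),
    (stepOp a α β)^[t] (fun s => F s + G s) =
      fun s => (stepOp a α β)^[t] F s + (stepOp a α β)^[t] G s := by
  induction t with
  | zero => intro F G; rfl
  | succ t ih => intro F G; rw [Function.iterate_succ_apply, stepOp_add, ih]; rfl

/-- Additive drift lower bound. -/
lemma lower_of_potential {n : ℕ} (hn : 0 < n) (a : Fin n → ℤ) (α β : ℝ)
    (Inv : RlsState n → Prop)
    (hInv : ∀ s i b, Inv s → Inv (rlsUpdate a α β s i b))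
    (h0 : Inv ((fun _ => 0), fun _ => 1)) (H : RlsState n → ℝ) (B : ℝ)
    (hH : ∀ s, Inv s → H s ≤ nonOpt a s + stepOp a α β H s)
    (hB : ∀ s, Inv s → H s ≤ B * nonOpt a s) :
    ENNReal.ofReal (H ((fun _ => 0), fun _ => 1)) ≤ rlsExpTime n a α β := by
  rw [expTime_eq hn]
  set s0 : RlsState n := ((fun _ => 0), fun _ => 1)
  set u : ℕ → ℝ := fun t => (stepOp a α β)^[t] (nonOpt a) s0 with hu
  have hu0 : ∀ t, 0 ≤ u t := fun t => stepOp_iter_nonneg a α β t (nonOpt_nonneg a) s0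
  have key : ∀ t, H s0 ≤ ∑ k ∈ Finset.range t, u k + (stepOp a α β)^[t] H s0 := by
    intro t
    induction t with
    | zero => simp
    | succ t ih =>
      have := stepOp_iter_mono a α β Inv hInv t hH s0 h0
      rw [stepOp_iter_add a α β t] at this
      rw [Finset.sum_range_succ, Function.iterate_succ_apply]
      have h2 : (stepOp a α β)^[t] H s0 ≤ u t + (stepOp a α β)^[t] (stepOp a α β H) s0 := this
      linarith
  have key2 : ∀ t, H s0 ≤ ∑ k ∈ Finset.range t, u k + B * u t := by
    intro t
    have := stepOp_iter_mono a α β Inv hInv t hB s0 h0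
    rw [stepOp_iter_smul a α β B t] at this
    have h2 : (stepOp a α β)^[t] H s0 ≤ B * u t := this
    linarith [key t]
  by_cases htop : (∑' t : ℕ, ENNReal.ofReal (u t)) = ⊤
  · exact htop ▸ le_top
  have hsum : Summable u := by
    have := ENNReal.summable_toReal htop
    simpa [ENNReal.toReal_ofReal, hu0] using this
  rw [← ENNReal.ofReal_tsum_of_nonneg hu0 hsum]
  apply ENNReal.ofReal_le_ofReal
  have l1 := hsum.hasSum.tendsto_sum_nat.add (hsum.tendsto_atTop_zero.const_mul B)
  have := ge_of_tendsto' l1 key2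
  simpa using this

lemma fitness_update {n : ℕ} (a x : Fin n → ℤ) (i : Fin n) (z : ℤ) :
    fitness a (Function.update x i z) + (x i - a i).natAbs =
      fitness a x + (z - a i).natAbs := by
  unfold fitness
  rw [← Finset.add_sum_erase _ _ (Finset.mem_univ i),
    ← Finset.add_sum_erase Finset.univ (fun j => (x j - a j).natAbs) (Finset.mem_univ i)]
  have : ∑ j ∈ Finset.univ.erase i, (Function.update x i z j - a j).natAbs =
      ∑ j ∈ Finset.univ.erase i, (x j - a j).natAbs :=
    Finset.sum_congr rfl fun j hj => by
      rw [Function.update_of_ne (Finset.ne_of_mem_erase hj)]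
  rw [this, Function.update_self]
  omega

/-- Distance of coordinate `i` to the optimum. -/
def cdist {n : ℕ} (a : Fin n → ℤ) (s : RlsState n) (i : Fin n) : ℕ := (s.1 i - a i).natAbs

lemma upd_fst_ne {n : ℕ} (a : Fin n → ℤ) (α β : ℝ) (s : RlsState n) {i j : Fin n} (b : Bool)
    (h : j ≠ i) : cdist a (rlsUpdate a α β s i b) j = cdist a s j := by
  unfold cdist rlsUpdate
  simp only
  split_ifs <;> simp [Function.update_of_ne h]

lemma upd_snd_ne {n : ℕ} (a : Fin n → ℤ) (α β : ℝ) (s : RlsState n) {i j : Fin n} (b : Bool)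
    (h : j ≠ i) : (rlsUpdate a α β s i b).2 j = s.2 j := by
  unfold rlsUpdate
  simp only
  rw [Function.update_of_ne h]

lemma upd_same {n : ℕ} (a : Fin n → ℤ) (α β : ℝ) (s : RlsState n) (i : Fin n) (b : Bool)
    (z : ℕ) (hz : z = (s.1 i + (if b then ⌊s.2 i⌋ else -⌊s.2 i⌋) - a i).natAbs) :
    cdist a (rlsUpdate a α β s i b) i = min z (cdist a s i) ∧
    (rlsUpdate a α β s i b).2 i =
      if z < cdist a s i then α * s.2 i else max 1 (β * s.2 i) := by
  have hf := fitness_update a s.1 i (s.1 i + (if b then ⌊s.2 i⌋ else -⌊s.2 i⌋))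
  have h1 : fitness a (Function.update s.1 i (s.1 i + (if b then ⌊s.2 i⌋ else -⌊s.2 i⌋)))
      ≤ fitness a s.1 ↔ z ≤ cdist a s i := by unfold cdist; omega
  have h2 : fitness a (Function.update s.1 i (s.1 i + (if b then ⌊s.2 i⌋ else -⌊s.2 i⌋)))
      < fitness a s.1 ↔ z < cdist a s i := by unfold cdist; omega
  constructor
  · unfold rlsUpdate
    simp only [h1]
    by_cases h : z ≤ cdist a s i
    · rw [if_pos h, min_eq_left h]
      simp only [cdist, Function.update_self]
      exact hz.symm
    · rw [if_neg h, min_eq_right (by omega)]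
      simp only [cdist]
  · unfold rlsUpdate
    simp only [h2, Function.update_self]

/-- Case analysis of one update at the chosen coordinate. -/
lemma upd_cases {n : ℕ} (a : Fin n → ℤ) (α β : ℝ) (s : RlsState n) (i : Fin n) (b : Bool)
    (hv : 1 ≤ s.2 i) :
    (cdist a (rlsUpdate a α β s i b) i = cdist a s i ∧
      (rlsUpdate a α β s i b).2 i = max 1 (β * s.2 i)) ∨
    (cdist a (rlsUpdate a α β s i b) i < cdist a s i ∧
      (cdist a s i : ℝ) ≤ cdist a (rlsUpdate a α β s i b) i + s.2 i ∧
      (rlsUpdate a α β s i b).2 i = α * s.2 i) := by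
  obtain ⟨h1, h2⟩ := upd_same a α β s i b _ rfl
  have hw : 1 ≤ ⌊s.2 i⌋ := Int.le_floor.2 (by simpa using hv)
  have hw2 := Int.floor_le (s.2 i)
  generalize hz : (s.1 i + (if b then ⌊s.2 i⌋ else -⌊s.2 i⌋) - a i).natAbs = z at h1 h2
  by_cases h : z < cdist a s i
  · right
    rw [if_pos h] at h2
    rw [h1, min_eq_left h.le]
    refine ⟨h, ?_, h2⟩
    have : (cdist a s i : ℤ) ≤ z + ⌊s.2 i⌋ := by
      unfold cdist; split_ifs at hz <;> omega
    have h' : ((cdist a s i : ℤ) : ℝ) ≤ ((z + ⌊s.2 i⌋ : ℤ) : ℝ) := by exact_mod_cast this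
    push_cast at h'
    linarith
  · left
    rw [if_neg h] at h2
    exact ⟨by rw [h1]; omega, h2⟩

lemma upd_sum {n : ℕ} (a : Fin n → ℤ) (α β : ℝ) (s : RlsState n) (i : Fin n)
    (hv : 1 ≤ s.2 i) (φ : ℕ → ℝ → ℝ) :
    ∑ b : Bool, φ (cdist a (rlsUpdate a α β s i b) i) ((rlsUpdate a α β s i b).2 i) =
      φ (cdist a s i) (max 1 (β * s.2 i)) +
      if s.2 i < 2 * cdist a s i then
        φ ((cdist a s i : ℤ) - ⌊s.2 i⌋).natAbs (α * s.2 i)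
      else φ (cdist a s i) (max 1 (β * s.2 i)) := by
  obtain ⟨h1, h2⟩ := upd_same a α β s i true _ rfl
  obtain ⟨h3, h4⟩ := upd_same a α β s i false _ rfl
  have hw : 1 ≤ ⌊s.2 i⌋ := Int.le_floor.2 (by simpa using hv)
  have hlt : s.2 i < 2 * cdist a s i ↔ ⌊s.2 i⌋ < 2 * (cdist a s i : ℤ) := by
    rw [Int.floor_lt]; push_cast; rfl
  rw [Fintype.sum_bool, h1, h2, h3, h4]
  simp only [hlt]
  generalize ⌊s.2 i⌋ = w at *
  simp only [if_true, Bool.false_eq_true, if_false]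
  have hc : cdist a s i = (s.1 i - a i).natAbs := rfl
  generalize cdist a s i = d at *
  rcases le_or_gt 0 (s.1 i - a i) with he | he
  · have e1 : ¬ (s.1 i + w - a i).natAbs < d := by omega
    have e2 : min (s.1 i + w - a i).natAbs d = d := by omega
    have e3 : (s.1 i + -w - a i).natAbs = ((d : ℤ) - w).natAbs := by omega
    rw [if_neg e1, e2, e3]
    congr 1
    by_cases h : w < 2 * (d : ℤ)
    · rw [if_pos h, if_pos (by omega), min_eq_left (by omega)]
    · rw [if_neg h, if_neg (by omega), min_eq_right (by omega)]
  · have e1 : ¬ (s.1 i + -w - a i).natAbs < d := by omega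
    have e2 : min (s.1 i + -w - a i).natAbs d = d := by omega
    have e3 : (s.1 i + w - a i).natAbs = ((d : ℤ) - w).natAbs := by omega
    rw [if_neg e1, e2, e3, add_comm]
    congr 1
    by_cases h : w < 2 * (d : ℤ)
    · rw [if_pos h, if_pos (by omega), min_eq_left (by omega)]
    · rw [if_neg h, if_neg (by omega), min_eq_right (by omega)]

lemma upd_valid {n : ℕ} (a : Fin n → ℤ) {α β : ℝ} (hα : 1 < α) (s : RlsState n) (i : Fin n)
    (b : Bool) (hs : ∀ j, 1 ≤ s.2 j) : ∀ j, 1 ≤ (rlsUpdate a α β s i b).2 j := by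
  intro j
  by_cases h : j = i
  · subst h
    rcases upd_cases a α β s j b (hs j) with h | h
    · rw [h.2]; exact le_max_left _ _
    · rw [h.2.2]; nlinarith [hs j]
  · rw [upd_snd_ne a α β s b h]; exact hs j

lemma fitness_zero_iff {n : ℕ} (a : Fin n → ℤ) (s : RlsState n) :
    fitness a s.1 = 0 ↔ ∀ i, cdist a s i = 0 := by
  unfold fitness cdist
  simp

lemma fitness_ne {n : ℕ} (a : Fin n → ℤ) (s : RlsState n) {i : Fin n} (h : cdist a s i ≠ 0) :
    nonOpt a s = 1 := by
  unfold nonOpt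
  rw [if_neg]
  rw [fitness_zero_iff]
  exact fun h' => h (h' i)

/-- The single-coordinate potential. -/
noncomputable def pot (p : ℕ) (d : ℕ) (v : ℝ) : ℝ :=
  if d = 0 then 0 else if v < 1.9 * d then (d : ℝ) ^ (p + 2) / (2 * v)
  else (d : ℝ) ^ (p + 1) + (d : ℝ) ^ p * v / 10

lemma pot_nonneg (p d : ℕ) {v : ℝ} (hv : 1 ≤ v) : 0 ≤ pot p d v := by
  have : 0 ≤ v := by linarith
  unfold pot; split_ifs <;> positivity

lemma pot_ge (p d : ℕ) {v : ℝ} (hv : 1 ≤ v) (hd : 1 ≤ d) : 1 / 4 ≤ pot p d v := by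
  have hd' : (1 : ℝ) ≤ d := by exact_mod_cast hd
  have h1 : (1 : ℝ) ≤ (d : ℝ) ^ (p + 1) := one_le_pow₀ hd'
  have hv0 : 0 < v := by linarith
  unfold pot
  rw [if_neg (by omega)]
  split_ifs with h
  · rw [le_div_iff₀ (by positivity), pow_succ]
    nlinarith
  · have : 0 ≤ (d : ℝ) ^ p * v / 10 := by positivity
    linarith

lemma pot_init (p d : ℕ) : pot p d 1 ≤ (d : ℝ) ^ (p + 2) := by
  unfold pot
  split_ifs with h h2
  · positivity
  · have : (0 : ℝ) ≤ (d : ℝ) ^ (p + 2) := by positivity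
    linarith
  · have : (1 : ℝ) ≤ d := by exact_mod_cast Nat.one_le_iff_ne_zero.2 h
    exfalso; linarith

set_option maxHeartbeats 2000000 in
lemma pot_drift {α β : ℝ} (hα₁ : 1 < α) (hα₂ : α ≤ 2)
    (hβ₁ : 1 / 2 < β) (hβ₂ : β ≤ 0.9) (h1 : 0 < 2 * α * β - β - α) :
    ∃ (p : ℕ) (δ : ℝ), 0 < δ ∧ δ < 1 ∧ ∀ (d : ℕ) (v : ℝ), 1 ≤ d → 1 ≤ v →
      (pot p d (max 1 (β * v)) +
      if v < 2 * d then pot p ((d : ℤ) - ⌊v⌋).natAbs (α * v)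
      else pot p d (max 1 (β * v))) ≤ 2 * (1 - δ) * pot p d v := by
  have hβ0 : 0 < β := by linarith
  have hα0 : 0 < α := by linarith
  have hb2 : 0 < 2 - 1 / β := by
    rw [sub_pos, div_lt_iff₀ hβ0]; linarith
  have hab : 0 < 2 - (1 / α + 1 / β) := by
    rw [sub_pos, div_add_div _ _ hα0.ne' hβ0.ne', div_lt_iff₀ (by positivity)]; linarith
  obtain ⟨p, hp⟩ := exists_pow_lt_of_lt_one (show 0 < (2 - 1 / β) / 14 by positivity)
    (show (0.9 : ℝ) < 1 by norm_num)
  set δ : ℝ := min (1 / 100) (min ((2 - (1 / α + 1 / β)) / 2) ((2 - 1 / β) / 4)) with hδ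
  have d1 : δ ≤ 1 / 100 := min_le_left _ _
  have d2 : δ ≤ (2 - (1 / α + 1 / β)) / 2 := (min_le_right _ _).trans (min_le_left _ _)
  have d3 : δ ≤ (2 - 1 / β) / 4 := (min_le_right _ _).trans (min_le_right _ _)
  have d0 : 0 < δ := by rw [hδ]; positivity
  clear_value δ
  refine ⟨p, δ, d0, by linarith, fun d v hd hv => ?_⟩
  have hv0 : 0 < v := by linarith
  have hD : (1 : ℝ) ≤ d := by exact_mod_cast hd
  have hw1 := Int.floor_le v
  have hw2 := Int.lt_floor_add_one v
  have hw3 : 1 ≤ ⌊v⌋ := Int.le_floor.2 (by simpa using hv)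
  have hw3' : (1 : ℝ) ≤ (⌊v⌋ : ℝ) := by exact_mod_cast hw3
  set e : ℕ := ((d : ℤ) - ⌊v⌋).natAbs with he
  have heR : (e : ℝ) = |(d : ℝ) - ⌊v⌋| := by
    rw [he, Nat.cast_natAbs]; push_cast; rfl
  generalize (⌊v⌋ : ℝ) = w at *
  have hdne : d ≠ 0 := by omega
  have hαv : v ≤ α * v := by nlinarith
  have hαv2 : α * v ≤ 2 * v := by nlinarith
  have hm1 : β * v ≤ max 1 (β * v) := le_max_right _ _
  have hβv : 0 < β * v := by positivity
  have hβv2 : β * v ≤ 0.9 * v := by nlinarith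
  have hX : 0 < (d : ℝ) ^ p := by positivity
  have hE : 0 ≤ (e : ℝ) := by positivity
  -- bound of the decreasing branch
  have hbeta : v < 2 * d → pot p d (max 1 (β * v)) ≤ (d : ℝ) ^ (p + 2) / (2 * v) * (1 / β) := by
    intro hlt
    have hm : max 1 (β * v) < 1.9 * d := by
      apply max_lt <;> linarith
    unfold pot
    rw [if_neg hdne, if_pos hm]
    have : (d : ℝ) ^ (p + 2) / (2 * v) * (1 / β) = (d : ℝ) ^ (p + 2) / (2 * (β * v)) := by
      field_simp
    rw [this]
    gcongr
  by_cases c1 : v < d / 4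
  · -- small velocity
    have hlt : v < 2 * d := by linarith
    rw [if_pos hlt]
    have hpot : pot p d v = (d : ℝ) ^ (p + 2) / (2 * v) := by
      unfold pot; rw [if_neg hdne, if_pos (by linarith)]
    have heR' : (e : ℝ) = d - w := by rw [heR, abs_of_nonneg (by linarith)]
    have hene : e ≠ 0 := by
      intro h0; rw [h0] at heR'; push_cast at heR'; linarith
    have ha : pot p e (α * v) ≤ (d : ℝ) ^ (p + 2) / (2 * v) * (1 / α) := by
      unfold pot
      rw [if_neg hene, if_pos (by linarith)]
      have : (d : ℝ) ^ (p + 2) / (2 * v) * (1 / α) = (d : ℝ) ^ (p + 2) / (2 * (α * v)) := by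
        field_simp
      rw [this]
      have hedN : e ≤ d := by
        have : (e : ℝ) ≤ d := by linarith
        exact_mod_cast this
      gcongr
    have hb := hbeta hlt
    rw [hpot]
    set Y := (d : ℝ) ^ (p + 2) / (2 * v)
    have hY : 0 < Y := by positivity
    nlinarith
  by_cases c2 : v < 1.9 * d
  · have hlt : v < 2 * d := by linarith
    rw [if_pos hlt]
    have hpot : pot p d v = (d : ℝ) ^ (p + 2) / (2 * v) := by
      unfold pot; rw [if_neg hdne, if_pos c2]
    have hb := hbeta hlt
    rw [hpot]
    set Y := (d : ℝ) ^ (p + 2) / (2 * v) with hYd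
    have hY : 0 < Y := by positivity
    have hYge : (d : ℝ) ^ p * d ≤ 3.8 * Y := by
      rw [hYd, mul_div_assoc', le_div_iff₀ (by positivity)]
      have : (d : ℝ) ^ (p + 2) = (d : ℝ) ^ p * d * d := by ring
      rw [this]
      have : 0 < (d : ℝ) ^ p * d := by positivity
      nlinarith
    have he9 : (e : ℝ) ≤ 0.9 * d := by
      rw [heR, abs_le]; constructor <;> linarith
    have hedN : e ≤ d := by
      have : (e : ℝ) ≤ d := by linarith
      exact_mod_cast this
    have hep : (e : ℝ) ^ p ≤ 0.9 ^ p * (d : ℝ) ^ p := by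
      rw [← mul_pow]; gcongr
    have h9 : (0 : ℝ) < 0.9 ^ p := by positivity
    have ha : pot p e (α * v) ≤ 7 * (0.9 ^ p) * Y := by
      unfold pot
      split_ifs with g1 g2
      · positivity
      · have : (e : ℝ) ^ (p + 2) / (2 * (α * v)) ≤ (0.9 ^ p * (d : ℝ) ^ p * (d * d)) / (2 * v) := by
          have : (e : ℝ) ^ (p + 2) ≤ 0.9 ^ p * (d : ℝ) ^ p * (d * d) := by
            have : (e : ℝ) ^ (p + 2) = (e : ℝ) ^ p * (e * e) := by ring
            rw [this]
            gcongr
          gcongr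
        have e2 : (0.9 ^ p * (d : ℝ) ^ p * (d * d)) / (2 * v) = 0.9 ^ p * Y := by
          rw [hYd]; ring
        rw [e2] at this
        have : 0 < 0.9 ^ p * Y := by positivity
        linarith
      · have t1 : (e : ℝ) ^ (p + 1) ≤ 0.9 ^ p * (d : ℝ) ^ p * d := by
          rw [pow_succ]; gcongr
        have t2 : (e : ℝ) ^ p * (α * v) / 10 ≤ 0.9 ^ p * (d : ℝ) ^ p * (3.8 * d) / 10 := by
          have : α * v ≤ 3.8 * d := by linarith
          gcongr
        have t3 : 0.9 ^ p * ((d : ℝ) ^ p * d) ≤ 0.9 ^ p * (3.8 * Y) := by gcongr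
        have : 0 < 0.9 ^ p * Y := by positivity
        linarith
    have : 7 * (0.9 ^ p) * Y ≤ (2 - 1 / β) / 2 * Y := by
      gcongr; linarith
    nlinarith
  · have hpot : pot p d v = (d : ℝ) ^ (p + 1) + (d : ℝ) ^ p * v / 10 := by
      unfold pot; rw [if_neg hdne, if_neg c2]
    rw [hpot]
    have hXd : (d : ℝ) ^ (p + 1) = (d : ℝ) ^ p * d := pow_succ _ _
    have hXdd : (d : ℝ) ^ (p + 2) = (d : ℝ) ^ p * d * d := by ring
    by_cases c3 : v < 2 * d
    · rw [if_pos c3]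
      have hb := hbeta c3
      have hb' : (d : ℝ) ^ (p + 2) / (2 * v) * (1 / β) ≤ 0.53 * ((d : ℝ) ^ p * d) := by
        rw [hXdd, div_mul_div_comm, div_le_iff₀ (by positivity)]
        have : 0 < (d : ℝ) ^ p * d := by positivity
        have : 1.9 * d * (1 / 2) ≤ v * β := by
          apply mul_le_mul <;> linarith
        nlinarith
      have hed : (e : ℝ) ≤ d := by
        rw [heR, abs_le]; constructor <;> linarith
      have hedN : e ≤ d := by exact_mod_cast hed
      have ha : pot p e (α * v) ≤ 1.4 * ((d : ℝ) ^ p * d) := by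
        unfold pot
        split_ifs with g1 g2
        · positivity
        · exfalso; linarith
        · have t1 : (e : ℝ) ^ (p + 1) ≤ (d : ℝ) ^ (p + 1) := by gcongr
          have t2 : (e : ℝ) ^ p * (α * v) / 10 ≤ (d : ℝ) ^ p * (4 * d) / 10 := by
            have : α * v ≤ 4 * d := by linarith
            gcongr
          linarith
      have : (d : ℝ) ^ p * (1.9 * d) ≤ (d : ℝ) ^ p * v := by gcongr; linarith
      have : 0 < (d : ℝ) ^ p * d := by positivity
      have : 0 < (d : ℝ) ^ p * v := by positivity
      nlinarith
    · rw [if_neg c3]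
      have hm : max 1 (β * v) = β * v := max_eq_right (by nlinarith)
      rw [hm]
      have q1 : (d : ℝ) ^ p * (2 * d) ≤ (d : ℝ) ^ p * v := by gcongr; linarith
      have q2 : 0 < (d : ℝ) ^ p * d := by positivity
      have q3 : 0 < (d : ℝ) ^ p * v := by positivity
      have : pot p d (β * v) ≤ (1 - 1 / 100) * ((d : ℝ) ^ (p + 1) + (d : ℝ) ^ p * v / 10) := by
        unfold pot
        rw [if_neg hdne]
        split_ifs with g2
        · have : (d : ℝ) ^ (p + 2) / (2 * (β * v)) ≤ 0.5 * ((d : ℝ) ^ p * d) := by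
            rw [hXdd, div_le_iff₀ (by positivity)]
            have : (d : ℝ) ≤ β * v := by nlinarith
            nlinarith
          linarith
        · have : (d : ℝ) ^ p * (β * v) ≤ (d : ℝ) ^ p * (0.9 * v) := by gcongr
          linarith
      nlinarith

lemma lower_log {n : ℕ} (hn : 0 < n) (a : Fin n → ℤ) {α β : ℝ} (hα₁ : 1 < α) (hα₂ : α ≤ 2)
    (hβ₂ : β ≤ 0.9) (i : Fin n) :
    ENNReal.ofReal (n / Real.log 2 * Real.log (1 + (a i).natAbs)) ≤ rlsExpTime n a α β := by
  have hn' : (0 : ℝ) < n := by exact_mod_cast hn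
  have hl2 : 0 < Real.log 2 := Real.log_pos (by norm_num)
  set m := (a i).natAbs with hm
  have key := lower_of_potential hn a α β
    (fun s => (∀ j, 1 ≤ s.2 j) ∧ cdist a s i ≤ m) ?_ ?_
    (fun s => n / Real.log 2 * Real.log (1 + cdist a s i / s.2 i))
    (n / Real.log 2 * Real.log (1 + m)) ?_ ?_
  · have e : cdist a ((fun _ => 0), fun _ => 1) i = m := by simp [cdist, hm]
    rw [e] at key
    simpa using key
  · rintro s j b ⟨h1, h2⟩
    refine ⟨upd_valid a hα₁ s j b h1, ?_⟩
    by_cases h : i = j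
    · subst h
      rcases upd_cases a α β s i b (h1 i) with h | h <;> omega
    · rw [upd_fst_ne a α β s b h]; exact h2
  · exact ⟨fun j => le_rfl, by simp [cdist, hm]⟩
  · rintro s ⟨h1, h2⟩
    have hvi := h1 i
    have hv0 : 0 < s.2 i := by linarith
    by_cases hd : cdist a s i = 0
    · have : (n : ℝ) / Real.log 2 * Real.log (1 + cdist a s i / s.2 i) = 0 := by simp [hd]
      simp only [this]
      refine add_nonneg (nonOpt_nonneg a s) (Finset.sum_nonneg fun j _ =>
        Finset.sum_nonneg fun b _ => mul_nonneg (by positivity) (mul_nonneg (by positivity)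
          (Real.log_nonneg ?_)))
      have := upd_valid (β := β) a hα₁ s j b h1 i
      have : 0 ≤ (cdist a (rlsUpdate a α β s j b) i : ℝ) / (rlsUpdate a α β s j b).2 i := by
        positivity
      linarith
    · rw [fitness_ne a s hd]
      set L := Real.log (1 + cdist a s i / s.2 i) with hL
      have step : ∀ j b, L - (if j = i then Real.log 2 else 0) ≤
          Real.log (1 + cdist a (rlsUpdate a α β s j b) i / (rlsUpdate a α β s j b).2 i) := by
        intro j b
        by_cases h : j = i
        · subst h
          rw [if_pos rfl]
          rcases upd_cases a α β s j b (h1 j) with h | h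
          · rw [h.1, h.2]
            have hle : max 1 (β * s.2 j) ≤ s.2 j := max_le hvi (by nlinarith)
            have hpos : 0 < max 1 (β * s.2 j) := by positivity
            have : L ≤ Real.log (1 + cdist a s j / max 1 (β * s.2 j)) := by
              rw [hL]
              apply Real.log_le_log (by positivity)
              gcongr
            linarith
          · obtain ⟨g1, g2, g3⟩ := h
            rw [g3, hL, ← Real.log_div (by positivity) (by norm_num)]
            apply Real.log_le_log (by positivity)
            have : (cdist a (rlsUpdate a α β s j b) j : ℝ) / (2 * s.2 j) ≤
                cdist a (rlsUpdate a α β s j b) j / (α * s.2 j) := by gcongr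
            refine le_trans ?_ (add_le_add_right this 1)
            rw [div_le_iff₀ (by norm_num)]
            have e : (1 + (cdist a (rlsUpdate a α β s j b) j : ℝ) / (2 * s.2 j)) * 2 =
                1 + (cdist a (rlsUpdate a α β s j b) j + s.2 j) / s.2 j := by
              field_simp; ring
            rw [e]
            gcongr
        · rw [if_neg h, sub_zero, upd_fst_ne a α β s b (Ne.symm h),
            upd_snd_ne a α β s b (Ne.symm h)]
      have : ∑ j : Fin n, ∑ b : Bool, (1 / (2 * (n : ℝ))) *
          (n / Real.log 2 * (L - (if j = i then Real.log 2 else 0))) ≤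
          stepOp a α β (fun s => n / Real.log 2 * Real.log (1 + cdist a s i / s.2 i)) s := by
        unfold stepOp
        refine Finset.sum_le_sum fun j _ => Finset.sum_le_sum fun b _ => ?_
        exact mul_le_mul_of_nonneg_left (mul_le_mul_of_nonneg_left (step j b) (by positivity))
          (by positivity)
      refine le_trans ?_ (add_le_add_right this 1)
      simp only [Fintype.sum_bool, ← two_mul]
      simp only [← Finset.mul_sum, Finset.sum_sub_distrib, Finset.sum_ite_eq',
        Finset.mem_univ, if_true, Finset.sum_const, Finset.card_univ, Fintype.card_fin,
        nsmul_eq_mul]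
      apply le_of_eq
      field_simp
      ring
  · rintro s ⟨h1, h2⟩
    have hvi := h1 i
    have hv0 : 0 < s.2 i := by linarith
    by_cases hd : cdist a s i = 0
    · simp only [hd, Nat.cast_zero, zero_div, add_zero, Real.log_one, mul_zero]
      refine mul_nonneg (mul_nonneg (by positivity) (Real.log_nonneg ?_)) (nonOpt_nonneg a s)
      have : (0 : ℝ) ≤ m := by positivity
      linarith
    · rw [fitness_ne a s hd, mul_one]
      have : (cdist a s i : ℝ) / s.2 i ≤ m := by
        rw [div_le_iff₀ hv0]
        have : (cdist a s i : ℝ) ≤ m := by exact_mod_cast h2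
        have : (0 : ℝ) ≤ m := by positivity
        nlinarith
      gcongr

/-- The number of non-optimal coordinates. -/
def badCount {n : ℕ} (a : Fin n → ℤ) (s : RlsState n) : ℕ :=
  (Finset.univ.filter fun i => cdist a s i ≠ 0).card

lemma lower_harm {n : ℕ} (hn : 0 < n) (a : Fin n → ℤ) {α β : ℝ} (hα₁ : 1 < α) :
    ENNReal.ofReal (n * ∑ k ∈ Finset.range (Finset.univ.filter fun i => a i ≠ 0).card,
      (1 / ((k : ℝ) + 1))) ≤ rlsExpTime n a α β := by
  have hn' : (0 : ℝ) < n := by exact_mod_cast hn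
  set h : ℕ → ℝ := fun m => ∑ k ∈ Finset.range m, (1 / ((k : ℝ) + 1)) with hh
  have hmono : Monotone h := by
    refine monotone_nat_of_le_succ fun m => ?_
    rw [hh]; simp only [Finset.sum_range_succ]
    have : (0 : ℝ) ≤ 1 / ((m : ℝ) + 1) := by positivity
    linarith
  have hnn : ∀ m, 0 ≤ h m := fun m => Finset.sum_nonneg fun k _ => by positivity
  have key := lower_of_potential hn a α β
    (fun s => ∀ j, 1 ≤ s.2 j) (fun s j b hs => upd_valid a hα₁ s j b hs) (fun j => le_rfl)
    (fun s => n * h (badCount a s)) (n * h n) ?_ ?_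
  · have e : badCount a ((fun _ => 0), fun _ => 1) =
        (Finset.univ.filter fun i => a i ≠ 0).card := by
      simp [badCount, cdist]
    rw [e] at key
    exact key
  · intro s hs
    set K := badCount a s with hK
    have step : ∀ i b, h K - (if cdist a s i ≠ 0 then 1 / (K : ℝ) else 0) ≤
        h (badCount a (rlsUpdate a α β s i b)) := by
      intro i b
      by_cases hi : cdist a s i ≠ 0
      · rw [if_pos hi]
        have hsub : (Finset.univ.filter fun j => cdist a s j ≠ 0).erase i ⊆
            Finset.univ.filter fun j => cdist a (rlsUpdate a α β s i b) j ≠ 0 := by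
          intro j hj
          rw [Finset.mem_erase, Finset.mem_filter] at hj
          rw [Finset.mem_filter, upd_fst_ne a α β s b hj.1]
          exact hj.2
        have hc := Finset.card_le_card hsub
        rw [Finset.card_erase_of_mem (by simp [hi])] at hc
        have hKpos : 0 < K := Finset.card_pos.2 ⟨i, by simp [hi]⟩
        obtain ⟨m, hm⟩ : ∃ m, K = m + 1 := ⟨K - 1, by omega⟩
        have hle : m ≤ badCount a (rlsUpdate a α β s i b) := by
          have : K - 1 ≤ badCount a (rlsUpdate a α β s i b) := hc
          omega
        refine le_trans ?_ (hmono hle)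
        rw [hm, hh]
        simp only [Finset.sum_range_succ]
        push_cast
        linarith
      · rw [if_neg hi, sub_zero]
        apply hmono
        apply Finset.card_le_card
        intro j hj
        rw [Finset.mem_filter] at hj ⊢
        have hji : j ≠ i := by rintro rfl; exact hi hj.2
        rw [upd_fst_ne a α β s b hji]
        exact hj
    have : ∑ i : Fin n, ∑ b : Bool, (1 / (2 * (n : ℝ))) *
        (n * (h K - (if cdist a s i ≠ 0 then 1 / (K : ℝ) else 0))) ≤
        stepOp a α β (fun s => n * h (badCount a s)) s := by
      unfold stepOp
      refine Finset.sum_le_sum fun j _ => Finset.sum_le_sum fun b _ => ?_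
      exact mul_le_mul_of_nonneg_left (mul_le_mul_of_nonneg_left (step j b) (by positivity))
        (by positivity)
    refine le_trans ?_ (add_le_add_right this _)
    simp only [Fintype.sum_bool, ← two_mul]
    rw [← Finset.mul_sum, ← Finset.mul_sum, ← Finset.mul_sum, Finset.sum_sub_distrib,
      ← Finset.sum_filter]
    simp only [Finset.sum_const, Finset.card_univ, Fintype.card_fin, nsmul_eq_mul]
    have e : (Finset.univ.filter fun i => cdist a s i ≠ 0).card = K := rfl
    rw [e]
    have e2 : 2 * (1 / (2 * (n : ℝ)) * (n * (n * h K - K * (1 / (K : ℝ))))) =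
        n * h K - K * (1 / (K : ℝ)) := by field_simp
    rw [e2]
    by_cases hK0 : K = 0
    · simp [hK0, nonOpt_nonneg]
    · obtain ⟨i, hi⟩ := Finset.card_pos.1 (Nat.pos_of_ne_zero hK0)
      rw [fitness_ne a s (Finset.mem_filter.1 hi).2]
      have : (K : ℝ) ≠ 0 := by exact_mod_cast hK0
      rw [mul_one_div_cancel this]
      linarith
  · intro s hs
    by_cases hK0 : badCount a s = 0
    · simp only [hK0]
      have : h 0 = 0 := by simp [hh]
      rw [this, mul_zero]
      exact mul_nonneg (mul_nonneg hn'.le (hnn _)) (nonOpt_nonneg a s)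
    · obtain ⟨i, hi⟩ := Finset.card_pos.1 (Nat.pos_of_ne_zero hK0)
      rw [fitness_ne a s (Finset.mem_filter.1 hi).2, mul_one]
      have : badCount a s ≤ n := by
        simpa [badCount] using Finset.card_le_univ (Finset.univ.filter fun i => cdist a s i ≠ 0)
      have := hmono this
      gcongr

lemma lower_bound {α β : ℝ} (hα₁ : 1 < α) (hα₂ : α ≤ 2) (hβ₂ : β ≤ 0.9) {n : ℕ}
    (a : Fin n → ℤ) (ha : a ≠ 0) :
    ENNReal.ofReal (1 / 2 * n * Real.log (normOne a)) ≤ rlsExpTime n a α β := by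
  obtain ⟨i0, hi0⟩ : ∃ i, a i ≠ 0 := by
    by_contra! h
    exact ha (funext h)
  have hn : 0 < n := lt_of_le_of_lt (Nat.zero_le _) i0.isLt
  obtain ⟨i, -, hi⟩ := Finset.exists_max_image Finset.univ (fun i => (a i).natAbs)
    ⟨i0, Finset.mem_univ _⟩
  set m := (a i).natAbs with hm
  set k := (Finset.univ.filter fun i => a i ≠ 0).card with hk
  have hm1 : 1 ≤ m := by
    have := hi i0 (Finset.mem_univ _)
    omega
  have hk1 : 1 ≤ k := Finset.card_pos.2 ⟨i0, by simp [hi0]⟩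
  have hle : normOne a ≤ k * m := by
    unfold normOne
    calc ∑ i, (a i).natAbs = ∑ i ∈ Finset.univ.filter (fun i => a i ≠ 0), (a i).natAbs := by
          rw [Finset.sum_filter]
          refine Finset.sum_congr rfl fun j _ => ?_
          split_ifs with h
          · rfl
          · simpa using h
      _ ≤ k * m := by
          have := Finset.sum_le_card_nsmul (Finset.univ.filter (fun i => a i ≠ 0))
            (fun i => (a i).natAbs) m (fun j _ => hi j (Finset.mem_univ _))
          simpa using this
  have hpos : 0 < normOne a := by
    unfold normOne
    exact Finset.sum_pos' (fun _ _ => Nat.zero_le _) ⟨i0, Finset.mem_univ _, by omega⟩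
  have hn' : (0 : ℝ) < n := by exact_mod_cast hn
  have hm' : (1 : ℝ) ≤ m := by exact_mod_cast hm1
  have hk' : (1 : ℝ) ≤ k := by exact_mod_cast hk1
  have hlog : Real.log (normOne a) ≤ Real.log k + Real.log m := by
    rw [← Real.log_mul (by positivity) (by positivity)]
    apply Real.log_le_log (by exact_mod_cast hpos)
    exact_mod_cast hle
  have hA := lower_log hn a hα₁ hα₂ hβ₂ i
  have hB := lower_harm (β := β) hn a hα₁
  have hl2 : 0 < Real.log 2 := Real.log_pos (by norm_num)
  have hl2' : Real.log 2 ≤ 1 := by linarith [Real.log_two_lt_d9]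
  have A1 : Real.log m ≤ 1 / Real.log 2 * Real.log (1 + m) := by
    have h1 : Real.log m ≤ Real.log (1 + m) := Real.log_le_log (by positivity) (by linarith)
    have h2 : 0 ≤ Real.log m := Real.log_nonneg hm'
    have h3 : 1 ≤ 1 / Real.log 2 := by rw [le_div_iff₀ hl2]; linarith
    nlinarith
  have B1 : Real.log k ≤ ∑ j ∈ Finset.range k, (1 / ((j : ℝ) + 1)) := by
    have h1 := log_add_one_le_harmonic k
    have h2 : Real.log k ≤ Real.log ((k + 1 : ℕ) : ℝ) :=
      Real.log_le_log (by positivity) (by push_cast; linarith)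
    have h3 : ((harmonic k : ℚ) : ℝ) = ∑ j ∈ Finset.range k, (1 / ((j : ℝ) + 1)) := by
      simp [harmonic]
    linarith
  rcases le_total (Real.log k) (Real.log m) with h | h
  · refine le_trans (ENNReal.ofReal_le_ofReal ?_) hA
    have : (n : ℝ) / Real.log 2 * Real.log (1 + m) = n * (1 / Real.log 2 * Real.log (1 + m)) := by
      ring
    rw [this]
    nlinarith
  · refine le_trans (ENNReal.ofReal_le_ofReal ?_) hB
    nlinarith

lemma total_drift {α β δ : ℝ} {p : ℕ}
    (hdrift : ∀ (d : ℕ) (v : ℝ), 1 ≤ d → 1 ≤ v →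
      (pot p d (max 1 (β * v)) +
      if v < 2 * d then pot p ((d : ℤ) - ⌊v⌋).natAbs (α * v)
      else pot p d (max 1 (β * v))) ≤ 2 * (1 - δ) * pot p d v)
    {n : ℕ} (hn : 0 < n) (a : Fin n → ℤ) (s : RlsState n) (hs : ∀ j, 1 ≤ s.2 j) :
    stepOp a α β (fun s => ∑ j, pot p (cdist a s j) (s.2 j)) s ≤
      (1 - δ / n) * ∑ j, pot p (cdist a s j) (s.2 j) := by
  have hn' : (0 : ℝ) < n := by exact_mod_cast hn
  unfold stepOp
  have step : ∀ i, ∑ b : Bool, ∑ j, pot p (cdist a (rlsUpdate a α β s i b) j)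
      ((rlsUpdate a α β s i b).2 j) ≤
      2 * ∑ j, pot p (cdist a s j) (s.2 j) - 2 * δ * pot p (cdist a s i) (s.2 i) := by
    intro i
    rw [Finset.sum_comm, Finset.mul_sum, ← Finset.add_sum_erase _ _ (Finset.mem_univ i),
      ← Finset.add_sum_erase _ (fun j => 2 * pot p (cdist a s j) (s.2 j)) (Finset.mem_univ i)]
    have e1 : ∑ j ∈ Finset.univ.erase i, ∑ b : Bool, pot p (cdist a (rlsUpdate a α β s i b) j)
        ((rlsUpdate a α β s i b).2 j) =
        ∑ j ∈ Finset.univ.erase i, 2 * pot p (cdist a s j) (s.2 j) := by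
      refine Finset.sum_congr rfl fun j hj => ?_
      have hji := Finset.ne_of_mem_erase hj
      simp only [upd_fst_ne a α β s _ hji, upd_snd_ne a α β s _ hji, Fintype.sum_bool]
      ring
    have e2 : ∑ b : Bool, pot p (cdist a (rlsUpdate a α β s i b) i)
        ((rlsUpdate a α β s i b).2 i) ≤ 2 * (1 - δ) * pot p (cdist a s i) (s.2 i) := by
      by_cases hd : cdist a s i = 0
      · have h0 : ∀ b, cdist a (rlsUpdate a α β s i b) i = 0 := by
          intro b
          rcases upd_cases a α β s i b (hs i) with h | h <;> omega
        simp [h0, hd, pot]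
      · rw [upd_sum a α β s i (hs i) (pot p)]
        exact hdrift _ _ (by omega) (hs i)
    rw [e1]
    linarith
  calc _ = (1 / (2 * (n : ℝ))) * ∑ i, ∑ b : Bool, ∑ j,
        pot p (cdist a (rlsUpdate a α β s i b) j) ((rlsUpdate a α β s i b).2 j) := by
        simp only [Finset.mul_sum]
    _ ≤ (1 / (2 * (n : ℝ))) * ∑ i : Fin n, (2 * ∑ j, pot p (cdist a s j) (s.2 j) -
        2 * δ * pot p (cdist a s i) (s.2 i)) := by
        refine mul_le_mul_of_nonneg_left (Finset.sum_le_sum fun i _ => step i) (by positivity)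
    _ = _ := by
        rw [Finset.sum_sub_distrib]
        simp only [Finset.sum_const, Finset.card_univ, Fintype.card_fin, nsmul_eq_mul]
        rw [← Finset.mul_sum]
        field_simp

lemma upper_bound {α β δ : ℝ} {p : ℕ} (hα₁ : 1 < α) (d0 : 0 < δ) (d1 : δ < 1)
    (hdrift : ∀ (d : ℕ) (v : ℝ), 1 ≤ d → 1 ≤ v →
      (pot p d (max 1 (β * v)) +
      if v < 2 * d then pot p ((d : ℤ) - ⌊v⌋).natAbs (α * v)
      else pot p d (max 1 (β * v))) ≤ 2 * (1 - δ) * pot p d v)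
    {n : ℕ} (a : Fin n → ℤ) (h2 : 2 ≤ normOne a) :
    rlsExpTime n a α β ≤
      ENNReal.ofReal (((p + 2) + 7 / Real.log 2) / δ * n * Real.log (normOne a)) := by
  have hn : 0 < n := by
    rcases Nat.eq_zero_or_pos n with rfl | h
    · simp [normOne] at h2
    · exact h
  have hn' : (1 : ℝ) ≤ n := by exact_mod_cast hn
  have hn0 : (0 : ℝ) < n := by linarith
  rw [expTime_eq hn]
  set s0 : RlsState n := ((fun _ => 0), fun _ => 1) with hs0
  set u : ℕ → ℝ := fun t => (stepOp a α β)^[t] (nonOpt a) s0 with hu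
  have hu0 : ∀ t, 0 ≤ u t := fun t => stepOp_iter_nonneg a α β t (nonOpt_nonneg a) s0
  set Φ : RlsState n → ℝ := fun s => ∑ j, pot p (cdist a s j) (s.2 j) with hΦ
  let Inv : RlsState n → Prop := fun s => ∀ j, 1 ≤ s.2 j
  have hInv : ∀ s i b, Inv s → Inv (rlsUpdate a α β s i b) :=
    fun s j b hs => upd_valid a hα₁ s j b hs
  have hI0 : Inv s0 := fun j => le_rfl
  set q : ℝ := 1 - δ / n with hq
  have hδn : δ / n < 1 := by rw [div_lt_one hn0]; linarith
  have hδn0 : 0 < δ / n := by positivity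
  have hq0 : 0 ≤ q := by rw [hq]; linarith
  have hq1 : q < 1 := by rw [hq]; linarith
  -- the chance of not being finished is at most one
  have hu1 : ∀ t, u t ≤ 1 := by
    intro t
    have hone : ∀ t, (stepOp a α β)^[t] (fun _ => 1) = fun _ => (1 : ℝ) := by
      intro t
      induction t with
      | zero => rfl
      | succ t ih =>
        rw [Function.iterate_succ_apply']
        rw [ih]
        funext s
        simp only [stepOp, Finset.sum_const, Finset.card_univ, Fintype.card_fin,
          Fintype.card_bool, nsmul_eq_mul]
        field_simp
        norm_num
    have := stepOp_iter_mono a α β Inv hInv t (F := nonOpt a) (G := fun _ => 1)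
      (fun s _ => by unfold nonOpt; split_ifs <;> norm_num) s0 hI0
    rw [hone t] at this
    exact this
  have hdec : ∀ t, ∀ s, Inv s → (stepOp a α β)^[t] Φ s ≤ q ^ t * Φ s := by
    intro t
    induction t with
    | zero => intro s _; simp
    | succ t ih =>
      intro s hs
      rw [Function.iterate_succ_apply]
      have h := stepOp_iter_mono a α β Inv hInv t (F := stepOp a α β Φ) (G := fun s => q * Φ s)
        (fun s hs => total_drift hdrift hn a s hs) s hs
      rw [stepOp_iter_smul] at h
      have h' : (stepOp a α β)^[t] (stepOp a α β Φ) s ≤ q * (stepOp a α β)^[t] Φ s := h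
      have := mul_le_mul_of_nonneg_left (ih s hs) hq0
      rw [pow_succ]
      linarith
  have hnP : ∀ s, Inv s → nonOpt a s ≤ 4 * Φ s := by
    intro s hs
    have hnn : ∀ j ∈ Finset.univ, 0 ≤ pot p (cdist a s j) (s.2 j) :=
      fun j _ => pot_nonneg p _ (hs j)
    unfold nonOpt
    split_ifs with h
    · exact mul_nonneg (by norm_num) (Finset.sum_nonneg hnn)
    · rw [fitness_zero_iff] at h
      push Not at h
      obtain ⟨i, hi⟩ := h
      have h1 := Finset.single_le_sum hnn (Finset.mem_univ i)
      have h2 := pot_ge p (cdist a s i) (hs i) (by omega)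
      have h3 : 1 / 4 ≤ Φ s := h2.trans h1
      linarith
  set N : ℝ := (normOne a : ℝ) with hN
  have hN2 : (2 : ℝ) ≤ N := by rw [hN]; exact_mod_cast h2
  have hΦ0 : Φ s0 ≤ N ^ (p + 2) := by
    have h1 : Φ s0 ≤ ∑ j, (((a j).natAbs : ℕ) : ℝ) ^ (p + 2) := by
      refine Finset.sum_le_sum fun j _ => ?_
      have e : cdist a s0 j = (a j).natAbs := by simp [cdist, hs0]
      rw [e]
      exact pot_init p _
    refine h1.trans ?_
    have e : N = ∑ j, (((a j).natAbs : ℕ) : ℝ) := by rw [hN, normOne]; push_cast; rfl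
    have hj : ∀ j, (((a j).natAbs : ℕ) : ℝ) ≤ N := by
      intro j
      rw [e]
      exact Finset.single_le_sum (f := fun j => (((a j).natAbs : ℕ) : ℝ))
        (fun _ _ => by positivity) (Finset.mem_univ j)
    calc ∑ j, (((a j).natAbs : ℕ) : ℝ) ^ (p + 2)
        ≤ ∑ j, N ^ (p + 1) * (((a j).natAbs : ℕ) : ℝ) := by
          refine Finset.sum_le_sum fun j _ => ?_
          rw [pow_succ]
          have := pow_le_pow_left₀ (by positivity) (hj j) (p + 1)
          gcongr
      _ = N ^ (p + 2) := by rw [← Finset.mul_sum, ← e]; ring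
  have hu2 : ∀ t, u t ≤ 4 * N ^ (p + 2) * q ^ t := by
    intro t
    have h := stepOp_iter_mono a α β Inv hInv t hnP s0 hI0
    rw [stepOp_iter_smul] at h
    have h' : u t ≤ 4 * (stepOp a α β)^[t] Φ s0 := h
    have h3 := hdec t s0 hI0
    have h4 : q ^ t * Φ s0 ≤ q ^ t * N ^ (p + 2) :=
      mul_le_mul_of_nonneg_left hΦ0 (by positivity)
    linarith
  -- summation
  have hl2 : 0 < Real.log 2 := Real.log_pos (by norm_num)
  have hlN : Real.log 2 ≤ Real.log N := Real.log_le_log (by norm_num) hN2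
  set t0 : ℕ := ⌈n / δ * ((p + 2) * Real.log N)⌉₊ with ht0
  have ht0a : n / δ * ((p + 2) * Real.log N) ≤ t0 := Nat.le_ceil _
  have ht0b : (t0 : ℝ) < n / δ * ((p + 2) * Real.log N) + 1 :=
    Nat.ceil_lt_add_one (by positivity)
  have hqt : N ^ (p + 2) * q ^ t0 ≤ 1 := by
    have h1 : q ≤ Real.exp (-(δ / n)) := by
      have := Real.add_one_le_exp (-(δ / n)); linarith
    have h2 : q ^ t0 ≤ Real.exp (-((p + 2) * Real.log N)) := by
      calc q ^ t0 ≤ Real.exp (-(δ / n)) ^ t0 := pow_le_pow_left₀ hq0 h1 _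
        _ = Real.exp (t0 * (-(δ / n))) := by rw [← Real.exp_nat_mul]
        _ ≤ _ := by
          apply Real.exp_le_exp.2
          have : δ / n * (n / δ * ((p + 2) * Real.log N)) ≤ δ / n * t0 := by gcongr
          have e : δ / n * (n / δ * ((p + 2) * Real.log N)) = (p + 2) * Real.log N := by
            field_simp
          linarith
    have h3 : Real.exp ((p + 2) * Real.log N) = N ^ (p + 2) := by
      have : ((p : ℝ) + 2) * Real.log N = ((p + 2 : ℕ) : ℝ) * Real.log N := by push_cast; ring
      rw [this, Real.exp_nat_mul, Real.exp_log (by linarith)]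
    have h4 : 0 < N ^ (p + 2) := by positivity
    calc N ^ (p + 2) * q ^ t0 ≤ N ^ (p + 2) * Real.exp (-((p + 2) * Real.log N)) := by gcongr
      _ = 1 := by rw [Real.exp_neg, h3]; field_simp
  have hsum : ∀ M, ∑ t ∈ Finset.range M, u t ≤ t0 + 4 * (n / δ) := by
    intro M
    calc ∑ t ∈ Finset.range M, u t ≤ ∑ t ∈ Finset.range (t0 + M), u t :=
          Finset.sum_le_sum_of_subset_of_nonneg
            (Finset.range_subset_range.2 (by omega)) (fun t _ _ => hu0 t)
      _ = ∑ t ∈ Finset.range t0, u t + ∑ k ∈ Finset.range M, u (t0 + k) :=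
          Finset.sum_range_add _ _ _
      _ ≤ ∑ t ∈ Finset.range t0, (1 : ℝ) + ∑ k ∈ Finset.range M, 4 * q ^ k := by
          refine add_le_add (Finset.sum_le_sum fun t _ => hu1 t)
            (Finset.sum_le_sum fun k _ => ?_)
          have h := hu2 (t0 + k)
          rw [pow_add q t0 k] at h
          have : N ^ (p + 2) * q ^ t0 * q ^ k ≤ 1 * q ^ k := by gcongr
          linarith
      _ ≤ t0 + 4 * (n / δ) := by
          rw [← Finset.mul_sum]
          have hg : ∑ k ∈ Finset.range M, q ^ k ≤ n / δ := by
            have h1 := (summable_geometric_of_lt_one hq0 hq1).sum_le_tsum (Finset.range M)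
              (fun k _ => by positivity)
            rw [tsum_geometric_of_lt_one hq0 hq1] at h1
            have : (1 - q)⁻¹ = n / δ := by rw [hq]; simp
            linarith
          simp
          linarith
  refine ENNReal.tsum_le_of_sum_range_le fun M => ?_
  rw [← ENNReal.ofReal_sum_of_nonneg (fun t _ => hu0 t)]
  apply ENNReal.ofReal_le_ofReal
  refine (hsum M).trans ?_
  have hnd : 1 ≤ (n : ℝ) / δ := by rw [le_div_iff₀ d0]; linarith
  have hr : 1 ≤ Real.log N / Real.log 2 := by rw [le_div_iff₀ hl2]; linarith
  have e : ((p + 2) + 7 / Real.log 2) / δ * n * Real.log N =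
      n / δ * ((p + 2) * Real.log N) + 7 * (n / δ * (Real.log N / Real.log 2)) := by
    field_simp
  rw [e]
  nlinarith

/-- **Tight bound for self-adjusting RLS.**
For all constants `α, β` satisfying `1 < α ≤ 2`, `1/2 < β ≤ 0.9`, `2αβ − β − α > 0`,
`α + β > 2` and `α²β > 1`, and every `a ∈ ℤⁿ \ {0ⁿ}`, the expected optimization time of
`RLS_{α,β}`, started with the all-`0` integer string and all-`1` velocity vector, on `f_a`
is `Θ(n · log |a|₁)` (the upper bound being asserted for `|a|₁ ≥ 2`, i.e. whenever
`log |a|₁ > 0`, as expressed by the asymptotic `Θ`-notation). -/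
theorem rls_tight_bound (α β : ℝ) (hα₁ : 1 < α) (hα₂ : α ≤ 2)
    (hβ₁ : 1 / 2 < β) (hβ₂ : β ≤ 0.9)
    (h1 : 0 < 2 * α * β - β - α) (h2 : 2 < α + β) (h3 : 1 < α ^ 2 * β) :
    ∃ c C : ℝ, 0 < c ∧ 0 < C ∧ ∀ (n : ℕ) (a : Fin n → ℤ), a ≠ 0 →
      ENNReal.ofReal (c * n * Real.log (normOne a)) ≤ rlsExpTime n a α β ∧
      (2 ≤ normOne a →
        rlsExpTime n a α β ≤ ENNReal.ofReal (C * n * Real.log (normOne a))) := by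
  obtain ⟨p, δ, d0, d1, hdrift⟩ := pot_drift hα₁ hα₂ hβ₁ hβ₂ h1
  refine ⟨1 / 2, ((p + 2) + 7 / Real.log 2) / δ, by norm_num, ?_, ?_⟩
  · have : 0 < Real.log 2 := Real.log_pos (by norm_num)
    positivity
  intro n a ha
  exact ⟨lower_bound hα₁ hα₂ hβ₂ a ha, upper_bound hα₁ d0 d1 hdrift a⟩
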